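/- arXiv:2105.14983 — 2 statements merged into one kernel-verified Lean document; each statement's English description precedes it below -/
import Mathlib

section
/- Let q ∈ [1,∞), let y ∈ ℝ^d, and let τ be a permutation of {1,…,d} with |y_{τ(1)}| ≥ … ≥ |y_{τ(d)}|. For l ∈ {1,…,d} set T_l(y) = (Σ_{j=1}^{l} |y_{τ(j)}|^q)^{1/q}. Let φ : {1,…,d} → (0,∞) be such that l ↦ φ(l)^q / l is nondecreasing on {1,…,d}. Then the map l ↦ T_l(y)/φ(l) is nonincreasing on {1,…,d}; that is, for all l ∈ {1,…,d−1}, T_{l+1}(y)/φ(l+1) ≤ T_l(y)/φ(l). -/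
theorem stmt13 (d : ℕ) (hd : 0 < d) (q : ℝ) (hq : 1 ≤ q)
    (y : EuclideanSpace ℝ (Fin d)) (τ : Equiv.Perm (Fin d))
    (hτ : ∀ j k : Fin d, j ≤ k → |y (τ k)| ≤ |y (τ j)|)
    (φ : ℕ → ℝ) (hφpos : ∀ l, 1 ≤ l → l ≤ d → 0 < φ l)
    (hφmono : ∀ l, 1 ≤ l → l + 1 ≤ d → φ l ^ q / (l : ℝ) ≤ φ (l + 1) ^ q / ((l : ℝ) + 1)) :
    ∀ l, 1 ≤ l → l + 1 ≤ d →
      (∑ j ∈ Finset.univ.filter (fun j : Fin d => (j : ℕ) < l + 1), |y (τ j)| ^ q) ^ (1 / q)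
          / φ (l + 1)
        ≤ (∑ j ∈ Finset.univ.filter (fun j : Fin d => (j : ℕ) < l), |y (τ j)| ^ q) ^ (1 / q)
          / φ l := by
  intro l hl hld
  have hq0 : q ≠ 0 := by positivity
  have hl0 : (0 : ℝ) < l := by exact_mod_cast hl
  have hφ := hφpos l hl (by omega)
  have hφ' := hφpos (l + 1) (by omega) hld
  have hsplit : Finset.univ.filter (fun j : Fin d => (j : ℕ) < l + 1)
      = insert ⟨l, hld⟩ (Finset.univ.filter (fun j : Fin d => (j : ℕ) < l)) := by
    ext j
    simp only [Finset.mem_filter, Finset.mem_univ, true_and, Finset.mem_insert, Fin.ext_iff]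
    omega
  have hcard : (Finset.univ.filter (fun j : Fin d => (j : ℕ) < l)).card = l := by
    rw [Fin.card_filter_val_lt]
    omega
  rw [hsplit, Finset.sum_insert (by simp)]
  set a := |y (τ ⟨l, hld⟩)| ^ q
  set S := ∑ j ∈ Finset.univ.filter (fun j : Fin d => (j : ℕ) < l), |y (τ j)| ^ q
  have ha0 : 0 ≤ a := by positivity
  have hS0 : 0 ≤ S := Finset.sum_nonneg fun _ _ => by positivity
  have hlast : l * a ≤ S := by
    have h := Finset.card_nsmul_le_sum
      (Finset.univ.filter (fun j : Fin d => (j : ℕ) < l)) (fun j => |y (τ j)| ^ q) a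
      fun j hj => Real.rpow_le_rpow (abs_nonneg _)
        (hτ j ⟨l, hld⟩ (Fin.le_def.mpr (Finset.mem_filter.mp hj).2.le)) (by positivity)
    rwa [hcard, nsmul_eq_mul] at h
  have hP : 0 < φ l ^ q := Real.rpow_pos_of_pos hφ q
  have hP' : 0 < φ (l + 1) ^ q := Real.rpow_pos_of_pos hφ' q
  have hmono := hφmono l hl hld
  rw [div_le_div_iff₀ hl0 (by positivity)] at hmono
  have hpow : (a + S) * φ l ^ q ≤ S * φ (l + 1) ^ q := by
    refine le_of_mul_le_mul_right ?_ hl0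
    nlinarith [mul_le_mul_of_nonneg_right hlast hP.le, mul_le_mul_of_nonneg_left hmono hS0]
  have hroot := Real.rpow_le_rpow (by positivity) hpow (by positivity : 0 ≤ 1 / q)
  rw [Real.mul_rpow (by positivity) hP.le, Real.mul_rpow hS0 hP'.le, one_div,
    Real.rpow_rpow_inv hφ.le hq0, Real.rpow_rpow_inv hφ'.le hq0, ← one_div] at hroot
  rwa [div_le_div_iff₀ hφ' hφ]
end

section
/- Let p ∈ [1,∞] and let B_p = {x ∈ ℝ^d : ‖x‖_p ≤ 1} be the unit ball of the ℓp-norm. Then the ℓ1-norm is the tightest norm below the ℓ0 pseudonorm on B_p: (i) for every x ∈ ℝ^d with ‖x‖_p ≤ 1, ‖x‖₁ ≤ ℓ0(x); and (ii) for every norm N on ℝ^d such that N(x) ≤ ℓ0(x) for all x ∈ B_p, one has N(x) ≤ ‖x‖₁ for all x ∈ ℝ^d. -/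
open scoped Classical ENNReal

/-- The ℓ0 pseudonorm: number of nonzero components. -/
noncomputable def l0 {d : ℕ} (x : EuclideanSpace ℝ (Fin d)) : ℕ :=
  (Finset.univ.filter fun i => x i ≠ 0).card

/-- The ℓp-norm on ℝ^d, for `p ∈ [1,∞]` (`p = ⊤` gives the sup-norm). -/
noncomputable def lpNorm {d : ℕ} (p : ℝ≥0∞) (x : EuclideanSpace ℝ (Fin d)) : ℝ :=
  if p = ⊤ then ⨆ i, |x i| else (∑ i, |x i| ^ p.toReal) ^ (1 / p.toReal)

/-- Every coordinate is bounded in absolute value by the ℓp-norm. -/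
theorem abs_apply_le_lpNorm {d : ℕ} {p : ℝ≥0∞} (hp : 1 ≤ p) (x : EuclideanSpace ℝ (Fin d))
    (i : Fin d) : |x i| ≤ lpNorm p x := by
  unfold lpNorm
  split_ifs with h
  · exact le_ciSup (f := fun i => |x i|) (Set.finite_range _).bddAbove i
  · have hp0 : 0 < p.toReal := ENNReal.toReal_pos (zero_lt_one.trans_le hp).ne' h
    calc |x i| = (|x i| ^ p.toReal) ^ (1 / p.toReal) := by
          rw [one_div, Real.rpow_rpow_inv (abs_nonneg _) hp0.ne']
      _ ≤ _ := by
          gcongr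
          exact Finset.single_le_sum (f := fun i => |x i| ^ p.toReal)
            (fun j _ => by positivity) (Finset.mem_univ i)

theorem lpNorm_single_one_le {d : ℕ} {p : ℝ≥0∞} (hp : 1 ≤ p) (i : Fin d) :
    lpNorm p (EuclideanSpace.single i (1 : ℝ)) ≤ 1 := by
  unfold lpNorm
  split_ifs with h
  · have : Nonempty (Fin d) := ⟨i⟩
    refine ciSup_le fun j => ?_
    by_cases hj : j = i <;> simp [hj]
  · have hp0 : 0 < p.toReal := ENNReal.toReal_pos (zero_lt_one.trans_le hp).ne' h
    rw [Finset.sum_eq_single i]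
    · simp
    · intro j _ hj
      simp [hj, hp0.ne']
    · simp

theorem l0_single_one {d : ℕ} (i : Fin d) : l0 (EuclideanSpace.single i (1 : ℝ)) = 1 := by
  rw [l0, Finset.card_eq_one]
  exact ⟨i, by ext j; by_cases hj : j = i <;> simp [hj]⟩

/-- A coordinatewise bound by one makes the ℓ1-norm at most the ℓ0 pseudonorm. -/
theorem sum_abs_le_l0 {d : ℕ} {x : EuclideanSpace ℝ (Fin d)} (hx : ∀ i, |x i| ≤ 1) :
    ∑ i, |x i| ≤ (l0 x : ℝ) := by
  rw [l0, Finset.card_filter, Nat.cast_sum]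
  refine Finset.sum_le_sum fun i _ => ?_
  by_cases hi : x i = 0
  · simp [hi]
  · simpa [hi] using hx i

theorem stmt14 (d : ℕ) (hd : 0 < d) (p : ℝ≥0∞) (hp : 1 ≤ p) :
    (∀ x : EuclideanSpace ℝ (Fin d), lpNorm p x ≤ 1 → ∑ i, |x i| ≤ (l0 x : ℝ))
    ∧ (∀ N : EuclideanSpace ℝ (Fin d) → ℝ,
      (∀ u v, N (u + v) ≤ N u + N v) →
      (∀ (ρ : ℝ) u, N (ρ • u) = |ρ| * N u) →
      (∀ u, 0 ≤ N u) → (∀ u, N u = 0 ↔ u = 0) →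
      (∀ x, lpNorm p x ≤ 1 → N x ≤ (l0 x : ℝ)) →
      ∀ x, N x ≤ ∑ i, |x i|) := by
  refine ⟨fun x hx => sum_abs_le_l0 fun i => (abs_apply_le_lpNorm hp x i).trans hx, ?_⟩
  intro N hadd hsmul _ hzero hN x
  have hsingle (i : Fin d) : N (EuclideanSpace.single i (1 : ℝ)) ≤ 1 := by
    simpa [l0_single_one] using hN _ (lpNorm_single_one_le hp i)
  have hx : x = ∑ i, x i • EuclideanSpace.single i (1 : ℝ) := by
    ext j
    simp [Pi.single_apply]
  calc N x = N (∑ i, x i • EuclideanSpace.single i (1 : ℝ)) := by rw [← hx]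
    _ ≤ ∑ i, N (x i • EuclideanSpace.single i (1 : ℝ)) :=
        Finset.le_sum_of_subadditive N ((hzero 0).2 rfl).le hadd _ _
    _ ≤ ∑ i, |x i| := Finset.sum_le_sum fun i _ => by
        rw [hsmul]
        exact mul_le_of_le_one_right (abs_nonneg _) (hsingle i)
end
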